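/- arXiv:1911.08642 — 8 statements merged into one kernel-verified Lean document; each statement's English description precedes it below -/
import Mathlib

section
/- Let A be a finite index set, C : A → ℕ, e a real number with e ≥ 0, and p, q : A → ℝ with p(a) ≥ 0, q(a) ≥ 0 and |q(a) − p(a)| ≤ e for every a ∈ A. Then for every real K ≥ 0, |K·∏_{a∈A} q(a)^{C(a)} − K·∏_{a∈A} p(a)^{C(a)}| ≤ K·(∏_{a∈A} (p(a)+e)^{C(a)} − ∏_{a∈A} p(a)^{C(a)}). -/
/-- If each `y i` is within `z i - x i` of `x i`, then the product of the `y i` is within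
`∏ z i - ∏ x i` of the product of the `x i`. -/
lemma abs_prod_sub_prod_le_prod_sub_prod {ι : Type*} (s : Finset ι) (x y z : ι → ℝ)
    (hx : ∀ i ∈ s, 0 ≤ x i) (hy : ∀ i ∈ s, 0 ≤ y i) (h : ∀ i ∈ s, |y i - x i| ≤ z i - x i) :
    |∏ i ∈ s, y i - ∏ i ∈ s, x i| ≤ ∏ i ∈ s, z i - ∏ i ∈ s, x i := by
  classical
  induction s using Finset.induction_on with
  | empty => simp
  | insert a s ha ih =>
    simp only [Finset.forall_mem_insert] at hx hy h
    have ih := ih hx.2 hy.2 h.2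
    rw [Finset.prod_insert ha, Finset.prod_insert ha, Finset.prod_insert ha]
    have hX : 0 ≤ ∏ i ∈ s, x i := Finset.prod_nonneg hx.2
    have hyz : y a ≤ z a := by linarith [le_abs_self (y a - x a), h.1]
    have hZX := (abs_nonneg _).trans ih
    calc |y a * ∏ i ∈ s, y i - x a * ∏ i ∈ s, x i|
        = |y a * (∏ i ∈ s, y i - ∏ i ∈ s, x i) + (y a - x a) * ∏ i ∈ s, x i| := by
          congr 1; ring
      _ ≤ y a * |∏ i ∈ s, y i - ∏ i ∈ s, x i| + |y a - x a| * ∏ i ∈ s, x i := by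
          refine (abs_add_le _ _).trans_eq ?_
          rw [abs_mul, abs_mul, abs_of_nonneg hy.1, abs_of_nonneg hX]
      _ ≤ z a * (∏ i ∈ s, z i - ∏ i ∈ s, x i) + (z a - x a) * ∏ i ∈ s, x i :=
          add_le_add (mul_le_mul hyz ih (abs_nonneg _) (hy.1.trans hyz))
            (mul_le_mul_of_nonneg_right h.1 hX)
      _ = z a * ∏ i ∈ s, z i - x a * ∏ i ∈ s, x i := by ring

/-- Corollary 1 (error bound on configuration probability): if each true
proportion `q a` is within `e` of the estimated proportion `p a`, then the
difference of the (scaled) multinomial probabilities is bounded by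
`K·(∏ (p a + e)^(C a) − ∏ (p a)^(C a))`. -/
theorem stmt_1 {A : Type*} [Fintype A] (C : A → ℕ) (e : ℝ) (he : 0 ≤ e)
    (p q : A → ℝ)
    (hp : ∀ a, 0 ≤ p a) (hq : ∀ a, 0 ≤ q a)
    (hpq : ∀ a, |q a - p a| ≤ e) :
    ∀ K : ℝ, 0 ≤ K →
      |K * ∏ a, (q a) ^ (C a) - K * ∏ a, (p a) ^ (C a)| ≤
        K * (∏ a, (p a + e) ^ (C a) - ∏ a, (p a) ^ (C a)) := by
  intro K hK
  rw [← mul_sub, abs_mul, abs_of_nonneg hK]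
  refine mul_le_mul_of_nonneg_left ?_ hK
  refine abs_prod_sub_prod_le_prod_sub_prod _ _ _ _ (fun a _ => pow_nonneg (hp a) _)
    (fun a _ => pow_nonneg (hq a) _) fun a _ => ?_
  simpa using abs_prod_sub_prod_le_prod_sub_prod (Finset.range (C a)) (fun _ => p a)
    (fun _ => q a) (fun _ => p a + e) (fun _ _ => hp a) (fun _ _ => hq a)
    (fun _ _ => by simpa using hpq a)
end

section
/- Let A be a finite index set, C : A → ℕ, p : A → ℝ, and e a real number with 0 ≤ e ≤ p(a) for every a ∈ A. Then ∏_{a∈A} (p(a)+e)^{C(a)} − ∏_{a∈A} p(a)^{C(a)} ≥ ∏_{a∈A} p(a)^{C(a)} − ∏_{a∈A} (p(a)−e)^{C(a)}. -/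
/-- If `yᵢ` is at most the mean of `zᵢ` and `xᵢ`, where `0 ≤ zᵢ ≤ xᵢ`, then the same holds for
products. -/
theorem two_mul_mul_le_mul_add_mul {x₁ y₁ z₁ x₂ y₂ z₂ : ℝ} (hzx₁ : z₁ ≤ x₁) (hy₁ : 0 ≤ y₁)
    (h₁ : 2 * y₁ ≤ x₁ + z₁) (hzx₂ : z₂ ≤ x₂) (hy₂ : 0 ≤ y₂) (h₂ : 2 * y₂ ≤ x₂ + z₂) :
    2 * (y₁ * y₂) ≤ x₁ * x₂ + z₁ * z₂ := by
  have hs : 2 * y₁ * (2 * y₂) ≤ (x₁ + z₁) * (x₂ + z₂) :=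
    mul_le_mul h₁ h₂ (by linarith) (by linarith)
  have hd : 0 ≤ (x₁ - z₁) * (x₂ - z₂) := mul_nonneg (by linarith) (by linarith)
  linarith

theorem two_mul_prod_le_prod_add_prod {ι : Type*} (s : Finset ι) {x y z : ι → ℝ}
    (hz : ∀ i ∈ s, 0 ≤ z i) (hzx : ∀ i ∈ s, z i ≤ x i) (hy : ∀ i ∈ s, 0 ≤ y i)
    (h : ∀ i ∈ s, 2 * y i ≤ x i + z i) :
    2 * ∏ i ∈ s, y i ≤ ∏ i ∈ s, x i + ∏ i ∈ s, z i := by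
  induction s using Finset.cons_induction with
  | empty => norm_num
  | cons a s ha ih =>
    simp only [Finset.forall_mem_cons] at hz hzx hy h
    simp only [Finset.prod_cons]
    exact two_mul_mul_le_mul_add_mul hzx.1 hy.1 h.1 (Finset.prod_le_prod hz.2 hzx.2)
      (Finset.prod_nonneg hy.2) (ih hz.2 hzx.2 hy.2 h.2)

/-- Eq. 17 of the appendix (step in the proof of Corollary 1): the maximal
overestimation error of the unnormalized multinomial probability mass
dominates the maximal underestimation error. -/
theorem stmt_3 {A : Type*} [Fintype A] (C : A → ℕ) (p : A → ℝ) (e : ℝ)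
    (he0 : 0 ≤ e) (hep : ∀ a, e ≤ p a) :
    ∏ a, (p a + e) ^ (C a) - ∏ a, (p a) ^ (C a) ≥
      ∏ a, (p a) ^ (C a) - ∏ a, (p a - e) ^ (C a) := by
  have hsub (a : A) : 0 ≤ p a - e := sub_nonneg.mpr (hep a)
  have hp (a : A) : 0 ≤ p a := he0.trans (hep a)
  have hle (a : A) : p a - e ≤ p a + e := by linarith
  have hpow (a : A) : 2 * p a ^ C a ≤ (p a + e) ^ C a + (p a - e) ^ C a := by
    have := two_mul_prod_le_prod_add_prod (Finset.range (C a)) (x := fun _ => p a + e)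
      (y := fun _ => p a) (z := fun _ => p a - e) (fun _ _ => hsub a) (fun _ _ => hle a)
      (fun _ _ => hp a) (fun _ _ => by linarith)
    simpa only [Finset.prod_const, Finset.card_range] using this
  have := two_mul_prod_le_prod_add_prod Finset.univ (fun a _ => pow_nonneg (hsub a) (C a))
    (fun a _ => pow_le_pow_left₀ (hsub a) (hle a) (C a)) (fun a _ => pow_nonneg (hp a) (C a))
    (fun a _ => hpow a)
  linarith
end

section
/- Let S be a finite type; let b : S → ℝ satisfy b(s) ≥ 0 for all s and ∑_{s∈S} b(s) = 1; let T : S → S → ℝ satisfy T(s,s') ≥ 0 and ∑_{s'∈S} T(s,s') = 1 for every s; let O : S → ℝ satisfy 0 ≤ O(s') ≤ 1 for every s'; and let ε ≥ 0 and p*, p : S → ℝ satisfy |p*(s) − p(s)| ≤ ε for all s. Define F*(s') = O(s')·∑_{s∈S} T(s,s')·p*(s)·b(s) and F(s') = O(s')·∑_{s∈S} T(s,s')·p(s)·b(s). Then ∑_{s'∈S} |F*(s') − F(s')| ≤ ε. -/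
/-- Lemma 3 (approximation error bound on belief updates): the ℓ¹ distance
between the true and estimated unnormalized belief-update vectors is at most
`ε`. -/
theorem stmt_6 {S : Type*} [Fintype S]
    (b : S → ℝ) (hb0 : ∀ s, 0 ≤ b s) (hb1 : ∑ s, b s = 1)
    (T : S → S → ℝ) (hT0 : ∀ s s', 0 ≤ T s s') (hT1 : ∀ s, ∑ s', T s s' = 1)
    (O : S → ℝ) (hO0 : ∀ s', 0 ≤ O s') (hO1 : ∀ s', O s' ≤ 1)
    (ε : ℝ) (hε : 0 ≤ ε)
    (pstar p : S → ℝ) (hp : ∀ s, |pstar s - p s| ≤ ε)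
    (Fstar F : S → ℝ)
    (hFstar : ∀ s', Fstar s' = O s' * ∑ s, T s s' * pstar s * b s)
    (hF : ∀ s', F s' = O s' * ∑ s, T s s' * p s * b s) :
    ∑ s', |Fstar s' - F s'| ≤ ε := by
  have pointwise (s' : S) : |Fstar s' - F s'| ≤ ∑ s, T s s' * (ε * b s) := by
    have hdiff : Fstar s' - F s' = O s' * ∑ s, T s s' * ((pstar s - p s) * b s) := by
      rw [hFstar, hF, ← mul_sub, ← Finset.sum_sub_distrib]
      congr 1
      exact Finset.sum_congr rfl fun s _ => by ring
    rw [hdiff, abs_mul, abs_of_nonneg (hO0 s')]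
    refine (mul_le_of_le_one_left (abs_nonneg _) (hO1 s')).trans ?_
    refine (Finset.abs_sum_le_sum_abs _ _).trans (Finset.sum_le_sum fun s _ => ?_)
    rw [abs_mul, abs_mul, abs_of_nonneg (hT0 s s'), abs_of_nonneg (hb0 s)]
    exact mul_le_mul_of_nonneg_left (mul_le_mul_of_nonneg_right (hp s) (hb0 s)) (hT0 s s')
  calc ∑ s', |Fstar s' - F s'| ≤ ∑ s', ∑ s, T s s' * (ε * b s) :=
        Finset.sum_le_sum fun s' _ => pointwise s'
    _ = ∑ s, (∑ s', T s s') * (ε * b s) := by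
        rw [Finset.sum_comm]
        simp_rw [Finset.sum_mul]
    _ = ε := by
        simp_rw [hT1, one_mul]
        rw [← Finset.mul_sum, hb1, mul_one]
end

section
/- Let S be a finite type and F*, F : S → ℝ with F*(s) ≥ 0 and F(s) ≥ 0 for all s. Set P* = ∑_{s∈S} F*(s) and P = ∑_{s∈S} F(s), and assume P* > 0, P > 0, and ∑_{s∈S} |F*(s) − F(s)| ≤ ε for some ε ≥ 0. Then P* · ∑_{s∈S} |F*(s)/P* − F(s)/P| ≤ 2·ε. -/
/-- Lemma 4: bound on `P*·‖B* − B‖₁` for the normalized updated beliefs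
`B*(s) = F*(s)/P*` and `B(s) = F(s)/P`. -/
theorem stmt_7 {S : Type*} [Fintype S]
    (Fstar F : S → ℝ) (hFstar0 : ∀ s, 0 ≤ Fstar s) (hF0 : ∀ s, 0 ≤ F s)
    (ε : ℝ) (hε : 0 ≤ ε)
    (hPstar : 0 < ∑ s, Fstar s) (hP : 0 < ∑ s, F s)
    (hl1 : ∑ s, |Fstar s - F s| ≤ ε) :
    (∑ s, Fstar s) *
        ∑ s, |Fstar s / (∑ s', Fstar s') - F s / (∑ s', F s')| ≤ 2 * ε := by
  have hdiff : |∑ s, F s - ∑ s, Fstar s| ≤ ε := by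
    rw [abs_sub_comm, ← Finset.sum_sub_distrib]
    exact (Finset.abs_sum_le_sum_abs _ _).trans hl1
  set Pstar := ∑ s, Fstar s
  set P := ∑ s, F s with hPdef
  have hterm (s : S) : Pstar * |Fstar s / Pstar - F s / P| ≤
      |Fstar s - F s| + F s * (|P - Pstar| / P) := by
    have hsplit : Pstar * (Fstar s / Pstar - F s / P) =
        (Fstar s - F s) + F s * ((P - Pstar) / P) := by
      field_simp
      ring
    calc Pstar * |Fstar s / Pstar - F s / P|
        = |(Fstar s - F s) + F s * ((P - Pstar) / P)| := by
          rw [← hsplit, abs_mul, abs_of_pos hPstar]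
      _ ≤ |Fstar s - F s| + |F s * ((P - Pstar) / P)| := abs_add_le _ _
      _ = |Fstar s - F s| + F s * (|P - Pstar| / P) := by
          rw [abs_mul, abs_div, abs_of_nonneg (hF0 s), abs_of_pos hP]
  calc Pstar * ∑ s, |Fstar s / Pstar - F s / P|
      = ∑ s, Pstar * |Fstar s / Pstar - F s / P| := Finset.mul_sum _ _ _
    _ ≤ ∑ s, (|Fstar s - F s| + F s * (|P - Pstar| / P)) :=
        Finset.sum_le_sum fun s _ => hterm s
    _ = ∑ s, |Fstar s - F s| + |P - Pstar| := by
        rw [Finset.sum_add_distrib, ← Finset.sum_mul, ← hPdef, mul_div_cancel₀ _ hP.ne']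
    _ ≤ 2 * ε := by linarith
end

section
/- Let S be a finite type and F*, F : S → ℝ nonnegative, with P* = ∑_{s∈S} F*(s) and P = ∑_{s∈S} F(s) satisfying 0 < P* ≤ 1 and 0 < P, and with ∑_{s∈S} |F*(s) − F(s)| ≤ ε for some ε ≥ 0. Let B*(s) = F*(s)/P* and B(s) = F(s)/P. Let L ≥ 0 and let V : (S → ℝ) → ℝ satisfy |V(x) − V(y)| ≤ L·∑_{s∈S} |x(s) − y(s)| for all x, y : S → ℝ, and 0 ≤ V(x) ≤ L for all x. Then |V(B*)·P* − V(B)·P| ≤ 3·ε·L. -/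
/-- Rescaled `ℓ¹`-distance between two normalized nonnegative vectors. -/
theorem sum_mul_sum_abs_div_sum_sub_le {S : Type*} [Fintype S] (f g : S → ℝ)
    (hg : ∀ s, 0 ≤ g s) (hf_sum : 0 < ∑ s, f s) (hg_sum : 0 < ∑ s, g s) :
    (∑ s, f s) * ∑ s, |f s / (∑ s', f s') - g s / (∑ s', g s')| ≤
      2 * ∑ s, |f s - g s| := by
  have hdiff : |∑ s, g s - ∑ s, f s| ≤ ∑ s, |f s - g s| := by
    rw [abs_sub_comm, ← Finset.sum_sub_distrib]
    exact Finset.abs_sum_le_sum_abs _ _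
  set p := ∑ s, f s
  set q := ∑ s, g s with hq
  have hterm : ∀ s, p * |f s / p - g s / q| ≤ |f s - g s| + g s / q * |q - p| := by
    intro s
    have hsplit : p * (f s / p - g s / q) = (f s - g s) + g s / q * (q - p) := by
      field_simp
      ring
    calc p * |f s / p - g s / q| = |p * (f s / p - g s / q)| := by
          rw [abs_mul, abs_of_pos hf_sum]
      _ ≤ |f s - g s| + |g s / q * (q - p)| := by
          rw [hsplit]
          exact abs_add_le _ _
      _ = |f s - g s| + g s / q * |q - p| := by
          rw [abs_mul, abs_of_nonneg (div_nonneg (hg s) hg_sum.le)]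
  calc p * ∑ s, |f s / p - g s / q|
      ≤ ∑ s, (|f s - g s| + g s / q * |q - p|) := by
        rw [Finset.mul_sum]
        exact Finset.sum_le_sum fun s _ => hterm s
    _ = ∑ s, |f s - g s| + |q - p| := by
        rw [Finset.sum_add_distrib, ← Finset.sum_mul, ← Finset.sum_div, ← hq,
          div_self hg_sum.ne', one_mul]
    _ ≤ 2 * ∑ s, |f s - g s| := by linarith

/-- Lemma 5: `|V(B*)·P* − V(B)·P| ≤ 3·ε·L` for the normalized updated beliefs
`B*(s) = F*(s)/P*`, `B(s) = F(s)/P`, where `V` is ℓ¹-Lipschitz with constant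
`L` and takes values in `[0, L]`. -/
theorem stmt_8 {S : Type*} [Fintype S]
    (Fstar F : S → ℝ) (hFstar0 : ∀ s, 0 ≤ Fstar s) (hF0 : ∀ s, 0 ≤ F s)
    (hPstar0 : 0 < ∑ s, Fstar s) (hPstar1 : ∑ s, Fstar s ≤ 1)
    (hP0 : 0 < ∑ s, F s)
    (ε : ℝ) (hε : 0 ≤ ε) (hl1 : ∑ s, |Fstar s - F s| ≤ ε)
    (L : ℝ) (hL : 0 ≤ L)
    (V : (S → ℝ) → ℝ)
    (hVlip : ∀ x y : S → ℝ, |V x - V y| ≤ L * ∑ s, |x s - y s|)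
    (hVrange : ∀ x : S → ℝ, 0 ≤ V x ∧ V x ≤ L) :
    |V (fun s => Fstar s / (∑ s', Fstar s')) * (∑ s, Fstar s) -
        V (fun s => F s / (∑ s', F s')) * (∑ s, F s)| ≤ 3 * ε * L := by
  have hnorm := sum_mul_sum_abs_div_sum_sub_le Fstar F hF0 hPstar0 hP0
  have hdiff : |∑ s, Fstar s - ∑ s, F s| ≤ ε := by
    rw [← Finset.sum_sub_distrib]
    exact (Finset.abs_sum_le_sum_abs _ _).trans hl1
  have hlip := hVlip (fun s => Fstar s / (∑ s', Fstar s')) (fun s => F s / (∑ s', F s'))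
  obtain ⟨hv0, hvL⟩ := hVrange (fun s => F s / (∑ s', F s'))
  set v := V (fun s => F s / (∑ s', F s'))
  set w := V (fun s => Fstar s / (∑ s', Fstar s'))
  set p := ∑ s, Fstar s
  set q := ∑ s, F s
  calc |w * p - v * q| = |(w - v) * p + v * (p - q)| := by ring_nf
    _ ≤ |w - v| * p + v * |p - q| := by
        refine (abs_add_le _ _).trans_eq ?_
        rw [abs_mul, abs_mul, abs_of_pos hPstar0, abs_of_nonneg hv0]
    _ ≤ L * (∑ s, |Fstar s / p - F s / q|) * p + L * ε := by gcongr
    _ = L * (p * ∑ s, |Fstar s / p - F s / q|) + L * ε := by ring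
    _ ≤ L * (2 * ε) + L * ε := by
        have := mul_le_mul_of_nonneg_left (hnorm.trans (by linarith : _ ≤ 2 * ε)) hL
        linarith
    _ = 3 * ε * L := by ring
end

section
/- Let 𝒞 and Ω be finite types and ℬ an arbitrary type. Let γ ∈ [0,1), Rmax ≥ 0, ε ≥ 0, δ ≥ 0. Let P, P* : 𝒞 × Ω → ℝ with P(C,o) ≥ 0 for all (C,o) and ∑_{(C,o)} P(C,o) = 1; let B, B* : 𝒞 × Ω → ℬ; let V, V* : ℬ → ℝ; and let r, r* ∈ ℝ. Assume: (i) |r* − r| ≤ ε·|𝒞|·Rmax; (ii) for every (C,o), |V*(B*(C,o))·P*(C,o) − V*(B(C,o))·P(C,o)| ≤ 3·ε·Rmax/(1−γ); and (iii) |V*(β) − V(β)| ≤ δ for every β ∈ ℬ. Define Q = r + γ·∑_{(C,o)} V(B(C,o))·P(C,o) and Q* = r* + γ·∑_{(C,o)} V*(B*(C,o))·P*(C,o). Then |Q* − Q| ≤ γ·δ + ε·|𝒞|·Rmax·(1 + 3·γ·|Ω|/(1−γ)). -/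
/-- Lemma 6 (approximation error bound on Q-values):
`|Q* − Q| ≤ γ·δ + ε·|𝒞|·Rmax·(1 + 3·γ·|Ω|/(1−γ))`. -/
theorem stmt_9 {𝒞 Ω : Type*} [Fintype 𝒞] [Fintype Ω] {ℬ : Type*}
    (γ : ℝ) (hγ0 : 0 ≤ γ) (hγ1 : γ < 1)
    (Rmax : ℝ) (hRmax : 0 ≤ Rmax)
    (ε : ℝ) (hε : 0 ≤ ε) (δ : ℝ) (hδ : 0 ≤ δ)
    (P Pstar : 𝒞 × Ω → ℝ)
    (hP0 : ∀ Co, 0 ≤ P Co) (hP1 : ∑ Co, P Co = 1)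
    (B Bstar : 𝒞 × Ω → ℬ)
    (V Vstar : ℬ → ℝ)
    (r rstar : ℝ)
    (hr : |rstar - r| ≤ ε * (Fintype.card 𝒞) * Rmax)
    (hVP : ∀ Co, |Vstar (Bstar Co) * Pstar Co - Vstar (B Co) * P Co| ≤
      3 * ε * Rmax / (1 - γ))
    (hVV : ∀ β : ℬ, |Vstar β - V β| ≤ δ) :
    |(rstar + γ * ∑ Co, Vstar (Bstar Co) * Pstar Co) -
        (r + γ * ∑ Co, V (B Co) * P Co)| ≤
      γ * δ + ε * (Fintype.card 𝒞) * Rmax *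
        (1 + 3 * γ * (Fintype.card Ω) / (1 - γ)) := by
  have hsum : |∑ Co, Vstar (Bstar Co) * Pstar Co - ∑ Co, V (B Co) * P Co| ≤
      (Fintype.card 𝒞) * (Fintype.card Ω) * (3 * ε * Rmax / (1 - γ)) + δ := by
    rw [← Finset.sum_sub_distrib]
    calc _ ≤ ∑ Co, |Vstar (Bstar Co) * Pstar Co - V (B Co) * P Co| :=
          Finset.abs_sum_le_sum_abs _ _
      _ ≤ ∑ Co, (3 * ε * Rmax / (1 - γ) + δ * P Co) := by
          refine Finset.sum_le_sum fun Co _ => (abs_sub_le _ (Vstar (B Co) * P Co) _).trans ?_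
          refine add_le_add (hVP Co) ?_
          rw [← sub_mul, abs_mul, abs_of_nonneg (hP0 Co)]
          exact mul_le_mul_of_nonneg_right (hVV _) (hP0 Co)
      _ = _ := by
          rw [Finset.sum_add_distrib, ← Finset.mul_sum, hP1]
          simp [Fintype.card_prod]
  calc _ = |(rstar - r) + γ * (∑ Co, Vstar (Bstar Co) * Pstar Co - ∑ Co, V (B Co) * P Co)| := by
        congr 1; ring
    _ ≤ |rstar - r| + γ * |∑ Co, Vstar (Bstar Co) * Pstar Co - ∑ Co, V (B Co) * P Co| := by
        refine (abs_add_le _ _).trans_eq ?_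
        rw [abs_mul, abs_of_nonneg hγ0]
    _ ≤ _ := add_le_add hr (mul_le_mul_of_nonneg_left hsum hγ0)
    _ = _ := by ring
end

section
/- Let S, 𝒞, Ω be finite types, γ ∈ [0,1), and Rmax ≥ 0, ε ≥ 0, φ ≥ 0 reals. Let b : S → ℝ with b(s) ≥ 0 and ∑_{s} b(s) = 1; R : S → 𝒞 → ℝ with |R(s,C)| ≤ Rmax for all s, C; p*, p : S → 𝒞 → ℝ with |p*(s,C) − p(s,C)| ≤ ε for all s, C; P*ᵢ : 𝒞 × Ω → ℝ with P*ᵢ(C,o) ≥ 0 and ∑_{(C,o)} P*ᵢ(C,o) = 1; and functions j, v, Pᵢ : 𝒞 × Ω → ℝ such that for every (C,o), |P*ᵢ(C,o)·j(C,o) − Pᵢ(C,o)·v(C,o)| ≤ P*ᵢ(C,o)·φ + 3·ε·Rmax/(1−γ). Define Vk = ∑_{s} b(s)·∑_{C} R(s,C)·p(s,C) + γ·∑_{(C,o)} Pᵢ(C,o)·v(C,o) and Jk = ∑_{s} b(s)·∑_{C} R(s,C)·p*(s,C) + γ·∑_{(C,o)} P*ᵢ(C,o)·j(C,o). Then |Vk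 − Jk| ≤ ε·|𝒞|·Rmax + 3·γ·|𝒞|·|Ω|·ε·Rmax/(1−γ) + γ·φ. -/
/-- Eq. 45 in the proof of Theorem 2 (regret bound), the one-step recurrence:
`|V_k − J_k| ≤ ε·|𝒞|·Rmax + 3·γ·|𝒞|·|Ω|·ε·Rmax/(1−γ) + γ·φ`. -/
theorem stmt_13 {S 𝒞 Ω : Type*} [Fintype S] [Fintype 𝒞] [Fintype Ω]
    (γ : ℝ) (hγ0 : 0 ≤ γ) (hγ1 : γ < 1)
    (Rmax ε φ : ℝ) (hRmax : 0 ≤ Rmax) (hε : 0 ≤ ε) (hφ : 0 ≤ φ)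
    (b : S → ℝ) (hb0 : ∀ s, 0 ≤ b s) (hb1 : ∑ s, b s = 1)
    (R : S → 𝒞 → ℝ) (hR : ∀ s C, |R s C| ≤ Rmax)
    (pstar p : S → 𝒞 → ℝ) (hp : ∀ s C, |pstar s C - p s C| ≤ ε)
    (Pistar : 𝒞 × Ω → ℝ) (hPistar0 : ∀ Co, 0 ≤ Pistar Co)
    (hPistar1 : ∑ Co, Pistar Co = 1)
    (j v Pi : 𝒞 × Ω → ℝ)
    (hjv : ∀ Co, |Pistar Co * j Co - Pi Co * v Co| ≤
      Pistar Co * φ + 3 * ε * Rmax / (1 - γ)) :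
    |(∑ s, b s * ∑ C, R s C * p s C + γ * ∑ Co, Pi Co * v Co) -
        (∑ s, b s * ∑ C, R s C * pstar s C + γ * ∑ Co, Pistar Co * j Co)| ≤
      ε * (Fintype.card 𝒞) * Rmax +
        3 * γ * (Fintype.card 𝒞) * (Fintype.card Ω) * ε * Rmax / (1 - γ) +
        γ * φ := by
  have hreward : |∑ s, b s * ∑ C, R s C * p s C - ∑ s, b s * ∑ C, R s C * pstar s C| ≤
      ε * (Fintype.card 𝒞) * Rmax := by
    rw [← Finset.sum_sub_distrib]
    calc |∑ s, (b s * ∑ C, R s C * p s C - b s * ∑ C, R s C * pstar s C)|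
        ≤ ∑ s, |b s * ∑ C, R s C * p s C - b s * ∑ C, R s C * pstar s C| :=
          Finset.abs_sum_le_sum_abs _ _
      _ ≤ ∑ s, b s * (ε * (Fintype.card 𝒞) * Rmax) := by
          refine Finset.sum_le_sum fun s _ => ?_
          rw [← mul_sub, abs_mul, abs_of_nonneg (hb0 s), ← Finset.sum_sub_distrib]
          refine mul_le_mul_of_nonneg_left ?_ (hb0 s)
          calc |∑ C, (R s C * p s C - R s C * pstar s C)|
              ≤ ∑ C, |R s C * p s C - R s C * pstar s C| := Finset.abs_sum_le_sum_abs _ _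
            _ ≤ ∑ _C : 𝒞, Rmax * ε := by
                refine Finset.sum_le_sum fun C _ => ?_
                rw [← mul_sub, abs_mul, abs_sub_comm]
                exact mul_le_mul (hR s C) (hp s C) (abs_nonneg _) hRmax
            _ = ε * (Fintype.card 𝒞) * Rmax := by
                rw [Finset.sum_const, Finset.card_univ, nsmul_eq_mul]
                ring
      _ = ε * (Fintype.card 𝒞) * Rmax := by rw [← Finset.sum_mul, hb1, one_mul]
  have hcont : |∑ Co, Pi Co * v Co - ∑ Co, Pistar Co * j Co| ≤
      φ + (Fintype.card 𝒞) * (Fintype.card Ω) * (3 * ε * Rmax / (1 - γ)) := by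
    rw [abs_sub_comm, ← Finset.sum_sub_distrib]
    calc |∑ Co, (Pistar Co * j Co - Pi Co * v Co)|
        ≤ ∑ Co, |Pistar Co * j Co - Pi Co * v Co| := Finset.abs_sum_le_sum_abs _ _
      _ ≤ ∑ Co, (Pistar Co * φ + 3 * ε * Rmax / (1 - γ)) :=
          Finset.sum_le_sum fun Co _ => hjv Co
      _ = φ + (Fintype.card 𝒞) * (Fintype.card Ω) * (3 * ε * Rmax / (1 - γ)) := by
          rw [Finset.sum_add_distrib, ← Finset.sum_mul, hPistar1, Finset.sum_const,
            Finset.card_univ, Fintype.card_prod, nsmul_eq_mul, Nat.cast_mul, one_mul]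
  rw [add_sub_add_comm, ← mul_sub]
  refine (abs_add_le _ _).trans ?_
  rw [abs_mul, abs_of_nonneg hγ0]
  refine (add_le_add hreward (mul_le_mul_of_nonneg_left hcont hγ0)).trans_eq ?_
  ring
end

section
/- Let S (states), 𝒞 (configurations), Ω (observations) be finite types, A a finite nonempty set of actions, γ ∈ [0,1) a discount, k ≥ 1 a horizon, and Rmax ≥ 0, ε ≥ 0 reals. For each a ∈ A let T_a : S → 𝒞 → S → ℝ be stochastic (nonnegative and summing to 1 over the next state for each (s,C)), O_a : S → 𝒞 → Ω → ℝ be stochastic (nonnegative and summing to 1 over observations for each (s',C)), and R_a : S → 𝒞 → ℝ satisfy |R_a(s,C)| ≤ Rmax. Let P, P* : S → 𝒞 → ℝ be nonnegative with ∑_C P(s,C) = ∑_C P*(s,C) = 1 for each s, and |P*(s,C) − P(s,C)| ≤ ε for all s, C. For a belief b : S → ℝ (nonnegative, summing to 1) and a ∈ A define R(b,a) = ∑_s b(s)·∑_C P(s,C)·R_a(s,C) and R*(b,a) analogously with P*; Pᵢ(C,o|b,a) = ∑_{s'} O_a(s',C,o)·∑_s T_a(s,C,s')·P(s,C)·b(s)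 and Pᵢ*(C,o|b,a) analogously with P*, both assumed strictly positive for all beliefs, actions, C and o; and belief updates B(b,a,C,o)(s') = O_a(s',C,o)·∑_s T_a(s,C,s')·P(s,C)·b(s) / Pᵢ(C,o|b,a), with B*(b,a,C,o) defined analogously from P* and Pᵢ*. Define V_0 = V*_0 = J_0 = 0; V_m(b) = max_{a∈A} [R(b,a) + γ·∑_{(C,o)} Pᵢ(C,o|b,a)·V_{m−1}(B(b,a,C,o))] with π_m(b) a maximizing action; V*_m(b) = max_{a∈A} [R*(b,a) + γ·∑_{(C,o)} Pᵢ*(C,o|b,a)·V*_{m−1}(B*(b,a,C,o))]; and J_m(b) = R*(b,π_m(b)) + γ·∑_{(C,o)} Pᵢ*(C,o|b,π_m(b))·J_{m−1}(B(b,π_m(b),C,o)). Then for every belief b, |V*_k(b) − J_k(b)| ≤ 2·ε·|𝒞|·Rmax·(γ^{k−1} + (1/(1−γ))·(1 + 3·γ·|Ω|/(1−γ))). -/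
namespace OpenPOMDP

/-- The suprema of two finite families that are uniformly `c`-close are `c`-close. -/
theorem abs_iSup_sub_iSup_le {A : Type*} [Finite A] [Nonempty A] {f g : A → ℝ} {c : ℝ}
    (h : ∀ a, |f a - g a| ≤ c) : |(⨆ a, f a) - ⨆ a, g a| ≤ c := by
  have key : ∀ {u v : A → ℝ}, (∀ a, |u a - v a| ≤ c) → (⨆ a, u a) ≤ (⨆ a, v a) + c :=
    fun {u v} huv => ciSup_le fun a => by
      have h1 := (abs_le.mp (huv a)).2
      have h2 := le_ciSup (Set.finite_range v).bddAbove a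
      linarith
  have h1 := key h
  have h2 := key (u := g) (v := f) fun a => by rw [abs_sub_comm]; exact h a
  exact abs_le.mpr ⟨by linarith, by linarith⟩

variable {S 𝒞 Ω : Type*} [Fintype S]

/-- The mass of next state `s'` together with the configuration-observation pair `c`, when the
current state and configuration are distributed according to the (signed) mass `z`. -/
def jointMass (T : S → 𝒞 → S → ℝ) (O : S → 𝒞 → Ω → ℝ) (z : S → 𝒞 → ℝ) (c : 𝒞 × Ω) (s' : S) : ℝ :=
  O s' c.1 c.2 * ∑ s, T s c.1 s' * z s c.1

variable {T : S → 𝒞 → S → ℝ} {O : S → 𝒞 → Ω → ℝ}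

theorem jointMass_sub (z z' : S → 𝒞 → ℝ) (c : 𝒞 × Ω) (s' : S) :
    jointMass T O (fun s C => z s C - z' s C) c s' =
      jointMass T O z c s' - jointMass T O z' c s' := by
  simp only [jointMass, ← mul_sub, ← Finset.sum_sub_distrib]

theorem jointMass_const_mul (p : ℝ) (z : S → 𝒞 → ℝ) (c : 𝒞 × Ω) (s' : S) :
    jointMass T O (fun s C => p * z s C) c s' = p * jointMass T O z c s' := by
  simp only [jointMass, Finset.mul_sum]
  exact Finset.sum_congr rfl fun s _ => by ring

theorem jointMass_nonneg (hT0 : ∀ s C s', 0 ≤ T s C s') (hO0 : ∀ s' C o, 0 ≤ O s' C o)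
    {z : S → 𝒞 → ℝ} (hz : ∀ s C, 0 ≤ z s C) (c : 𝒞 × Ω) (s' : S) :
    0 ≤ jointMass T O z c s' :=
  mul_nonneg (hO0 _ _ _) (Finset.sum_nonneg fun _ _ => mul_nonneg (hT0 _ _ _) (hz _ _))

variable [Fintype 𝒞] [Fintype Ω]

/-- Passing to the joint mass is a contraction for the `ℓ¹` norm. -/
theorem sum_abs_jointMass_le
    (hT0 : ∀ s C s', 0 ≤ T s C s') (hT1 : ∀ s C, ∑ s', T s C s' = 1)
    (hO0 : ∀ s' C o, 0 ≤ O s' C o) (hO1 : ∀ s' C, ∑ o, O s' C o = 1) (z : S → 𝒞 → ℝ) :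
    ∑ c, ∑ s', |jointMass T O z c s'| ≤ ∑ s, ∑ C, |z s C| := by
  calc ∑ c, ∑ s', |jointMass T O z c s'|
      ≤ ∑ c : 𝒞 × Ω, ∑ s', O s' c.1 c.2 * ∑ s, T s c.1 s' * |z s c.1| := by
        gcongr with c _ s' _
        rw [jointMass, abs_mul, abs_of_nonneg (hO0 _ _ _)]
        refine mul_le_mul_of_nonneg_left ?_ (hO0 _ _ _)
        refine (Finset.abs_sum_le_sum_abs _ _).trans_eq (Finset.sum_congr rfl fun s _ => ?_)
        rw [abs_mul, abs_of_nonneg (hT0 _ _ _)]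
    _ = ∑ C, ∑ s', (∑ o, O s' C o) * ∑ s, T s C s' * |z s C| := by
        rw [Fintype.sum_prod_type]
        refine Finset.sum_congr rfl fun C _ => ?_
        rw [Finset.sum_comm]
        simp only [Finset.sum_mul]
    _ = ∑ C, ∑ s, (∑ s', T s C s') * |z s C| := by
        refine Finset.sum_congr rfl fun C _ => ?_
        simp only [hO1, one_mul, Finset.sum_mul]
        exact Finset.sum_comm
    _ = ∑ s, ∑ C, |z s C| := by
        simp only [hT1, one_mul]
        exact Finset.sum_comm

/-- Comparison of two one-step Bellman backups whose continuation terms differ by at most a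
multiple `D` of the difference of the joint masses and a multiple `e` of the second one. -/
theorem abs_backup_sub_backup_le
    (hT0 : ∀ s C s', 0 ≤ T s C s') (hT1 : ∀ s C, ∑ s', T s C s' = 1)
    (hO0 : ∀ s' C o, 0 ≤ O s' C o) (hO1 : ∀ s' C, ∑ o, O s' C o = 1)
    {R : S → 𝒞 → ℝ} {Rmax γ D e : ℝ} (hR : ∀ s C, |R s C| ≤ Rmax)
    (hγ : 0 ≤ γ) (hD : 0 ≤ D) (he : 0 ≤ e) (z z' : S → 𝒞 → ℝ) (f f' : 𝒞 × Ω → ℝ)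
    (hf : ∀ c, |f c - f' c| ≤ D * ∑ s', |jointMass T O z c s' - jointMass T O z' c s'| +
      e * ∑ s', |jointMass T O z' c s'|) :
    |(∑ s, ∑ C, z s C * R s C + γ * ∑ c, f c) - (∑ s, ∑ C, z' s C * R s C + γ * ∑ c, f' c)| ≤
      (Rmax + γ * D) * ∑ s, ∑ C, |z s C - z' s C| + γ * e * ∑ s, ∑ C, |z' s C| := by
  have hrew : |∑ s, ∑ C, z s C * R s C - ∑ s, ∑ C, z' s C * R s C| ≤
      Rmax * ∑ s, ∑ C, |z s C - z' s C| := by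
    simp only [← Finset.sum_sub_distrib, ← sub_mul, Finset.mul_sum]
    refine (Finset.abs_sum_le_sum_abs _ _).trans (Finset.sum_le_sum fun s _ => ?_)
    refine (Finset.abs_sum_le_sum_abs _ _).trans (Finset.sum_le_sum fun C _ => ?_)
    rw [abs_mul, mul_comm]
    exact mul_le_mul_of_nonneg_right (hR s C) (abs_nonneg _)
  have hcont : |∑ c, f c - ∑ c, f' c| ≤
      D * ∑ s, ∑ C, |z s C - z' s C| + e * ∑ s, ∑ C, |z' s C| := by
    have hdiff := sum_abs_jointMass_le hT0 hT1 hO0 hO1 fun s C => z s C - z' s C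
    have hmass := sum_abs_jointMass_le hT0 hT1 hO0 hO1 z'
    simp only [jointMass_sub] at hdiff
    rw [← Finset.sum_sub_distrib]
    calc |∑ c, (f c - f' c)| ≤ ∑ c, |f c - f' c| := Finset.abs_sum_le_sum_abs _ _
      _ ≤ ∑ c, (D * ∑ s', |jointMass T O z c s' - jointMass T O z' c s'| +
            e * ∑ s', |jointMass T O z' c s'|) := Finset.sum_le_sum fun c _ => hf c
      _ ≤ _ := by
        rw [Finset.sum_add_distrib, ← Finset.mul_sum, ← Finset.mul_sum]
        gcongr
  have hγcont := mul_le_mul_of_nonneg_left hcont hγ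
  have hγabs : |γ * (∑ c, f c - ∑ c, f' c)| = γ * |∑ c, f c - ∑ c, f' c| := by
    rw [abs_mul, abs_of_nonneg hγ]
  have htri := abs_add_le (∑ s, ∑ C, z s C * R s C - ∑ s, ∑ C, z' s C * R s C)
    (γ * (∑ c, f c - ∑ c, f' c))
  rw [show ∀ a b c d : ℝ, (a + γ * b) - (c + γ * d) = (a - c) + γ * (b - d) from
    fun a b c d => by ring]
  linarith

theorem sum_abs_mul_eq {P : S → 𝒞 → ℝ} (hP0 : ∀ s C, 0 ≤ P s C) (hP1 : ∀ s, ∑ C, P s C = 1)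
    (x : S → ℝ) : ∑ s, ∑ C, |P s C * x s| = ∑ s, |x s| := by
  refine Finset.sum_congr rfl fun s _ => ?_
  simp only [abs_mul, abs_of_nonneg (hP0 _ _), ← Finset.sum_mul, hP1, one_mul]

theorem sum_abs_mul_sub_mul_le {P P' : S → 𝒞 → ℝ} {ε : ℝ} (h : ∀ s C, |P' s C - P s C| ≤ ε)
    {b : S → ℝ} (hb : b ∈ stdSimplex ℝ S) :
    ∑ s, ∑ C, |P s C * b s - P' s C * b s| ≤ Fintype.card 𝒞 * ε := by
  calc ∑ s, ∑ C, |P s C * b s - P' s C * b s| ≤ ∑ s, ∑ _C : 𝒞, ε * b s := by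
        gcongr with s _ C _
        rw [← sub_mul, abs_mul, abs_of_nonneg (hb.1 s), abs_sub_comm]
        exact mul_le_mul_of_nonneg_right (h s C) (hb.1 s)
    _ = Fintype.card 𝒞 * ε := by
        simp only [Finset.sum_const, Finset.card_univ, nsmul_eq_mul, ← Finset.mul_sum, hb.2,
          mul_one]

/-- A value function obtained by iterating Bellman backups is, after homogeneous extension,
`D`-Lipschitz for the `ℓ¹` norm as soon as `Rmax + γ * D ≤ D`. -/
theorem abs_mul_value_sub_le {A : Type*} [Finite A] [Nonempty A]
    {T : A → S → 𝒞 → S → ℝ} {O : A → S → 𝒞 → Ω → ℝ} {R : A → S → 𝒞 → ℝ} {P : S → 𝒞 → ℝ}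
    (hT0 : ∀ a s C s', 0 ≤ T a s C s') (hT1 : ∀ a s C, ∑ s', T a s C s' = 1)
    (hO0 : ∀ a s' C o, 0 ≤ O a s' C o) (hO1 : ∀ a s' C, ∑ o, O a s' C o = 1)
    {Rmax γ D : ℝ} (hR : ∀ a s C, |R a s C| ≤ Rmax) (hγ : 0 ≤ γ) (hD : 0 ≤ D)
    (hRD : Rmax + γ * D ≤ D)
    (hP0 : ∀ s C, 0 ≤ P s C) (hP1 : ∀ s, ∑ C, P s C = 1)
    {L : (S → ℝ) → A → 𝒞 × Ω → ℝ} {B : (S → ℝ) → A → 𝒞 × Ω → S → ℝ}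
    (hL : ∀ b ∈ stdSimplex ℝ S, ∀ a c, 0 ≤ L b a c)
    (hB : ∀ b ∈ stdSimplex ℝ S, ∀ a c, B b a c ∈ stdSimplex ℝ S)
    (hLB : ∀ b ∈ stdSimplex ℝ S, ∀ a c s',
      L b a c * B b a c s' = jointMass (T a) (O a) (fun s C => P s C * b s) c s')
    {V : ℕ → (S → ℝ) → ℝ} (hV0 : ∀ b, V 0 b = 0)
    (hV : ∀ m b, V (m + 1) b = ⨆ a, (∑ s, ∑ C, P s C * b s * R a s C +
      γ * ∑ c, L b a c * V m (B b a c))) (m : ℕ) :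
    ∀ b ∈ stdSimplex ℝ S, ∀ b' ∈ stdSimplex ℝ S, ∀ p q : ℝ, 0 ≤ p → 0 ≤ q →
      |p * V m b - q * V m b'| ≤ D * ∑ s, |p * b s - q * b' s| := by
  induction m with
  | zero =>
    intro b _ b' _ p q _ _
    simp only [hV0, mul_zero, sub_zero, abs_zero]
    positivity
  | succ m ih =>
    intro b hb b' hb' p q hp hq
    rw [hV, hV, Real.mul_iSup_of_nonneg hp, Real.mul_iSup_of_nonneg hq]
    refine abs_iSup_sub_iSup_le fun a => ?_
    have hscale : ∀ (r : ℝ) (x : S → ℝ), r * (∑ s, ∑ C, P s C * x s * R a s C +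
        γ * ∑ c, L x a c * V m (B x a c)) =
        ∑ s, ∑ C, (r * (P s C * x s)) * R a s C + γ * ∑ c, r * L x a c * V m (B x a c) := by
      intro r x
      simp only [mul_add, Finset.mul_sum]
      congr 1
      · exact Finset.sum_congr rfl fun s _ => Finset.sum_congr rfl fun C _ => by ring
      · exact Finset.sum_congr rfl fun c _ => by ring
    have hbackup := abs_backup_sub_backup_le (hT0 a) (hT1 a) (hO0 a) (hO1 a) (hR a) hγ hD le_rfl
      (fun s C => p * (P s C * b s)) (fun s C => q * (P s C * b' s))
      (fun c => p * L b a c * V m (B b a c)) (fun c => q * L b' a c * V m (B b' a c))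
      (fun c => by
        have h := ih _ (hB b hb a c) _ (hB b' hb' a c) (p * L b a c) (q * L b' a c)
          (mul_nonneg hp (hL b hb a c)) (mul_nonneg hq (hL b' hb' a c))
        simp only [mul_assoc, hLB b hb, hLB b' hb'] at h
        simp only [jointMass_const_mul, mul_assoc, zero_mul, add_zero]
        exact h)
    rw [hscale, hscale]
    refine hbackup.trans ?_
    rw [mul_zero, zero_mul, add_zero]
    have hsum := sum_abs_mul_eq hP0 hP1 fun s => p * b s - q * b' s
    have hcongr : ∑ s, ∑ C, |p * (P s C * b s) - q * (P s C * b' s)| =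
        ∑ s, |p * b s - q * b' s| := by
      rw [← hsum]
      exact Finset.sum_congr rfl fun s _ => Finset.sum_congr rfl fun C _ => by ring_nf
    rw [hcongr]
    gcongr

end OpenPOMDP

open OpenPOMDP in
/-- Theorem 2 (regret bound): the actual expected return `J_k` of the
`k`-horizon policy `π` computed from the estimated configuration
distribution `P` is within
`2·ε·|𝒞|·Rmax·(γ^{k−1} + (1/(1−γ))·(1 + 3·γ·|Ω|/(1−γ)))`
of the true optimal value `V*_k`, for every belief. -/
theorem stmt_14 {S 𝒞 Ω A : Type*}
    [Fintype S] [Fintype 𝒞] [Fintype Ω] [Fintype A] [Nonempty A]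
    (γ : ℝ) (hγ0 : 0 ≤ γ) (hγ1 : γ < 1)
    (k : ℕ) (hk : 1 ≤ k)
    (Rmax ε : ℝ) (hRmax : 0 ≤ Rmax) (hε : 0 ≤ ε)
    (T : A → S → 𝒞 → S → ℝ)
    (hT0 : ∀ a s C s', 0 ≤ T a s C s')
    (hT1 : ∀ a s C, ∑ s', T a s C s' = 1)
    (O : A → S → 𝒞 → Ω → ℝ)
    (hO0 : ∀ a s' C o, 0 ≤ O a s' C o)
    (hO1 : ∀ a s' C, ∑ o, O a s' C o = 1)
    (R : A → S → 𝒞 → ℝ) (hR : ∀ a s C, |R a s C| ≤ Rmax)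
    (P Pstar : S → 𝒞 → ℝ)
    (hP0 : ∀ s C, 0 ≤ P s C) (hPstar0 : ∀ s C, 0 ≤ Pstar s C)
    (hP1 : ∀ s, ∑ C, P s C = 1) (hPstar1 : ∀ s, ∑ C, Pstar s C = 1)
    (hPerr : ∀ s C, |Pstar s C - P s C| ≤ ε)
    -- expected one-step rewards under the estimated and true distributions
    (Rbel Rbelstar : (S → ℝ) → A → ℝ)
    (hRbel : ∀ b a, Rbel b a = ∑ s, b s * ∑ C, P s C * R a s C)
    (hRbelstar : ∀ b a, Rbelstar b a = ∑ s, b s * ∑ C, Pstar s C * R a s C)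
    -- joint configuration–observation likelihoods
    (Pi Pistar : (S → ℝ) → A → 𝒞 → Ω → ℝ)
    (hPi : ∀ b a C o,
      Pi b a C o = ∑ s', O a s' C o * ∑ s, T a s C s' * P s C * b s)
    (hPistar : ∀ b a C o,
      Pistar b a C o = ∑ s', O a s' C o * ∑ s, T a s C s' * Pstar s C * b s)
    -- strict positivity of the joint likelihoods at every belief
    (hPipos : ∀ b : S → ℝ, (∀ s, 0 ≤ b s) → (∑ s, b s = 1) →
      ∀ a C o, 0 < Pi b a C o ∧ 0 < Pistar b a C o)
    -- belief updates
    (Bel Belstar : (S → ℝ) → A → 𝒞 → Ω → S → ℝ)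
    (hBel : ∀ b a C o s', Bel b a C o s' =
      O a s' C o * (∑ s, T a s C s' * P s C * b s) / Pi b a C o)
    (hBelstar : ∀ b a C o s', Belstar b a C o s' =
      O a s' C o * (∑ s, T a s C s' * Pstar s C * b s) / Pistar b a C o)
    -- value functions and the policy computed from the estimated distribution
    (V Vstar J : ℕ → (S → ℝ) → ℝ) (π : ℕ → (S → ℝ) → A)
    (hV0 : ∀ b, V 0 b = 0) (hVstar0 : ∀ b, Vstar 0 b = 0)
    (hJ0 : ∀ b, J 0 b = 0)
    (hVrec : ∀ (m : ℕ) (b : S → ℝ), V (m + 1) b =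
      ⨆ a : A, (Rbel b a +
        γ * ∑ Co : 𝒞 × Ω, Pi b a Co.1 Co.2 * V m (Bel b a Co.1 Co.2)))
    (hπ : ∀ (m : ℕ) (b : S → ℝ), V (m + 1) b =
      Rbel b (π (m + 1) b) +
        γ * ∑ Co : 𝒞 × Ω, Pi b (π (m + 1) b) Co.1 Co.2 *
          V m (Bel b (π (m + 1) b) Co.1 Co.2))
    (hVstarrec : ∀ (m : ℕ) (b : S → ℝ), Vstar (m + 1) b =
      ⨆ a : A, (Rbelstar b a +
        γ * ∑ Co : 𝒞 × Ω, Pistar b a Co.1 Co.2 * Vstar m (Belstar b a Co.1 Co.2)))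
    (hJrec : ∀ (m : ℕ) (b : S → ℝ), J (m + 1) b =
      Rbelstar b (π (m + 1) b) +
        γ * ∑ Co : 𝒞 × Ω, Pistar b (π (m + 1) b) Co.1 Co.2 *
          J m (Bel b (π (m + 1) b) Co.1 Co.2)) :
    ∀ b : S → ℝ, (∀ s, 0 ≤ b s) → (∑ s, b s = 1) →
      |Vstar k b - J k b| ≤ 2 * ε * (Fintype.card 𝒞) * Rmax *
        (γ ^ (k - 1) +
          (1 / (1 - γ)) * (1 + 3 * γ * (Fintype.card Ω) / (1 - γ))) := by
  intro b₀ hb₀ hb₀'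
  have hγ : 0 < 1 - γ := by linarith
  set n : ℝ := (Fintype.card 𝒞 : ℝ)
  have hn0 : 0 ≤ n := Nat.cast_nonneg _
  set D : ℝ := Rmax / (1 - γ) with hD
  have hD0 : 0 ≤ D := by positivity
  have hRD : Rmax + γ * D = D := by rw [hD]; field_simp; ring
  set e : ℝ := n * ε * D / (1 - γ) with he
  have he0 : 0 ≤ e := by positivity
  have heD : D * (n * ε) + γ * e = e := by rw [he]; field_simp; ring
  have hreward : ∀ (Q : S → 𝒞 → ℝ) (b : S → ℝ) a,
      ∑ s, b s * ∑ C, Q s C * R a s C = ∑ s, ∑ C, Q s C * b s * R a s C := by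
    intro Q b a
    simp only [Finset.mul_sum]
    exact Finset.sum_congr rfl fun s _ => Finset.sum_congr rfl fun C _ => by ring
  simp only [hreward] at hRbel hRbelstar
  have hmass : ∀ (Q : S → 𝒞 → ℝ) (b : S → ℝ) a C o s',
      O a s' C o * ∑ s, T a s C s' * Q s C * b s =
        jointMass (T a) (O a) (fun s C => Q s C * b s) (C, o) s' := by
    intro Q b a C o s'
    simp only [jointMass, mul_assoc]
  simp only [hmass] at hPi hPistar hBel hBelstar
  have hpos : ∀ b ∈ stdSimplex ℝ S, ∀ a C o, 0 < Pi b a C o ∧ 0 < Pistar b a C o :=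
    fun b hb => hPipos b hb.1 hb.2
  have hnonneg : ∀ {Q : S → 𝒞 → ℝ}, (∀ s C, 0 ≤ Q s C) → ∀ b ∈ stdSimplex ℝ S, ∀ a c s',
      0 ≤ jointMass (T a) (O a) (fun s C => Q s C * b s) c s' := fun hQ b hb a c s' =>
    jointMass_nonneg (hT0 a) (hO0 a) (fun s C => mul_nonneg (hQ s C) (hb.1 s)) c s'
  have hLB : ∀ b ∈ stdSimplex ℝ S, ∀ a (c : 𝒞 × Ω) s', Pi b a c.1 c.2 * Bel b a c.1 c.2 s' =
      jointMass (T a) (O a) (fun s C => P s C * b s) c s' := fun b hb a c s' => by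
    rw [hBel, mul_div_cancel₀ _ (hpos b hb a c.1 c.2).1.ne']
  have hLBstar : ∀ b ∈ stdSimplex ℝ S, ∀ a (c : 𝒞 × Ω) s',
      Pistar b a c.1 c.2 * Belstar b a c.1 c.2 s' =
      jointMass (T a) (O a) (fun s C => Pstar s C * b s) c s' := fun b hb a c s' => by
    rw [hBelstar, mul_div_cancel₀ _ (hpos b hb a c.1 c.2).2.ne']
  have hBmem : ∀ b ∈ stdSimplex ℝ S, ∀ a C o, Bel b a C o ∈ stdSimplex ℝ S := by
    intro b hb a C o
    refine ⟨fun s' => ?_, ?_⟩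
    · rw [hBel]
      exact div_nonneg (hnonneg hP0 b hb a _ s') (hpos b hb a C o).1.le
    · simp only [hBel]
      rw [← Finset.sum_div, ← hPi, div_self (hpos b hb a C o).1.ne']
  have hBstarmem : ∀ b ∈ stdSimplex ℝ S, ∀ a C o, Belstar b a C o ∈ stdSimplex ℝ S := by
    intro b hb a C o
    refine ⟨fun s' => ?_, ?_⟩
    · rw [hBelstar]
      exact div_nonneg (hnonneg hPstar0 b hb a _ s') (hpos b hb a C o).2.le
    · simp only [hBelstar]
      rw [← Finset.sum_div, ← hPistar, div_self (hpos b hb a C o).2.ne']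
  have hPistar_abs : ∀ b ∈ stdSimplex ℝ S, ∀ a (c : 𝒞 × Ω), Pistar b a c.1 c.2 =
      ∑ s', |jointMass (T a) (O a) (fun s C => Pstar s C * b s) c s'| := by
    intro b hb a c
    rw [hPistar]
    exact Finset.sum_congr rfl fun s' _ => (abs_of_nonneg (hnonneg hPstar0 b hb a c s')).symm
  have hlip := abs_mul_value_sub_le hT0 hT1 hO0 hO1 hR hγ0 hD0 hRD.le hP0 hP1
    (L := fun b a c => Pi b a c.1 c.2) (B := fun b a c => Bel b a c.1 c.2)
    (fun b hb a c => (hpos b hb a c.1 c.2).1.le) (fun b hb a c => hBmem b hb a c.1 c.2) hLB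
    hV0 (fun m b => by simp only [hVrec, hRbel])
  have hVbound : ∀ m, ∀ b ∈ stdSimplex ℝ S, |V m b| ≤ D := by
    intro m b hb
    have h := hlip m b hb b hb 1 0 zero_le_one le_rfl
    simpa [abs_of_nonneg (hb.1 _), hb.2] using h
  have hstep : ∀ b ∈ stdSimplex ℝ S, ∀ a (f f' : 𝒞 × Ω → ℝ),
      (∀ c, |f c - f' c| ≤
        D * ∑ s', |jointMass (T a) (O a) (fun s C => P s C * b s) c s' -
          jointMass (T a) (O a) (fun s C => Pstar s C * b s) c s'| +
        e * Pistar b a c.1 c.2) →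
      |(Rbel b a + γ * ∑ c, f c) - (Rbelstar b a + γ * ∑ c, f' c)| ≤ e := by
    intro b hb a f f' hf
    simp only [hPistar_abs b hb] at hf
    rw [hRbel, hRbelstar]
    refine (abs_backup_sub_backup_le (hT0 a) (hT1 a) (hO0 a) (hO1 a) (hR a) hγ0 hD0 he0
      _ _ f f' hf).trans ?_
    have hsum : ∑ s, ∑ C, |Pstar s C * b s| = 1 := by
      rw [sum_abs_mul_eq hPstar0 hPstar1, ← hb.2]
      exact Finset.sum_congr rfl fun s _ => abs_of_nonneg (hb.1 s)
    rw [hsum, hRD, mul_one]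
    calc _ ≤ D * (n * ε) + γ * e := by
          gcongr
          exact sum_abs_mul_sub_mul_le hPerr hb
      _ = e := heD
  have hVVstar : ∀ m, ∀ b ∈ stdSimplex ℝ S, |V m b - Vstar m b| ≤ e := by
    intro m
    induction m with
    | zero => intro b _; simpa [hV0, hVstar0] using he0
    | succ m ih =>
      intro b hb
      rw [hVrec, hVstarrec]
      refine abs_iSup_sub_iSup_le fun a => hstep b hb a _ _ fun c => ?_
      have hmem := hBstarmem b hb a c.1 c.2
      have hPs := (hpos b hb a c.1 c.2).2.le
      have h1 := hlip m _ (hBmem b hb a c.1 c.2) _ hmem _ _ (hpos b hb a c.1 c.2).1.le hPs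
      simp only [hLB b hb, hLBstar b hb] at h1
      have h2 := mul_le_mul_of_nonneg_left (ih _ hmem) hPs
      rw [← abs_of_nonneg hPs, ← abs_mul, abs_of_nonneg hPs, mul_sub] at h2
      have h3 := abs_sub_le (Pi b a c.1 c.2 * V m (Bel b a c.1 c.2))
        (Pistar b a c.1 c.2 * V m (Belstar b a c.1 c.2))
        (Pistar b a c.1 c.2 * Vstar m (Belstar b a c.1 c.2))
      linarith
  have hVJ : ∀ m, ∀ b ∈ stdSimplex ℝ S, |V m b - J m b| ≤ e := by
    intro m
    induction m with
    | zero => intro b _; simpa [hV0, hJ0] using he0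
    | succ m ih =>
      intro b hb
      rw [hπ, hJrec]
      set a := π (m + 1) b
      refine hstep b hb a _ _ fun c => ?_
      have hmem := hBmem b hb a c.1 c.2
      have hPs := (hpos b hb a c.1 c.2).2.le
      have h1 : |Pi b a c.1 c.2 * V m (Bel b a c.1 c.2) -
          Pistar b a c.1 c.2 * V m (Bel b a c.1 c.2)| ≤
          D * ∑ s', |jointMass (T a) (O a) (fun s C => P s C * b s) c s' -
            jointMass (T a) (O a) (fun s C => Pstar s C * b s) c s'| := by
        rw [← sub_mul, abs_mul, mul_comm, hPi, hPistar, ← Finset.sum_sub_distrib]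
        exact mul_le_mul (hVbound m _ hmem) (Finset.abs_sum_le_sum_abs _ _) (abs_nonneg _) hD0
      have h2 := mul_le_mul_of_nonneg_left (ih _ hmem) hPs
      rw [← abs_of_nonneg hPs, ← abs_mul, abs_of_nonneg hPs, mul_sub] at h2
      have h3 := abs_sub_le (Pi b a c.1 c.2 * V m (Bel b a c.1 c.2))
        (Pistar b a c.1 c.2 * V m (Bel b a c.1 c.2))
        (Pistar b a c.1 c.2 * J m (Bel b a c.1 c.2))
      linarith
  have hS : Nonempty S := by
    by_contra h
    rw [not_nonempty_iff] at h
    simp at hb₀'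
  have hC : Nonempty 𝒞 := by
    by_contra h
    rw [not_nonempty_iff] at h
    simpa using hP1 hS.some
  have hΩ : Nonempty Ω := by
    by_contra h
    rw [not_nonempty_iff] at h
    simpa using hO1 (Classical.arbitrary A) hS.some hC.some
  have hw : (1 : ℝ) ≤ Fintype.card Ω := by exact_mod_cast Fintype.card_pos
  have hregret : |Vstar k b₀ - J k b₀| ≤ 2 * e := by
    have h1 := hVVstar k b₀ ⟨hb₀, hb₀'⟩
    have h2 := hVJ k b₀ ⟨hb₀, hb₀'⟩
    have h3 := abs_sub_le (Vstar k b₀) (V k b₀) (J k b₀)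
    rw [abs_sub_comm (Vstar k b₀) (V k b₀)] at h3
    linarith
  have he' : 2 * e = 2 * ε * n * Rmax * (0 + (1 / (1 - γ)) * (1 + 1 * γ * 1 / (1 - γ))) := by
    rw [he, hD]
    field_simp
    ring
  rw [he'] at hregret
  refine hregret.trans ?_
  gcongr
  · positivity
  · norm_num
end
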